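/- Let (Σ,σ) be a topologically transitive countable Markov shift with the F-property, and let φ : Σ → ℝ have summable variations, Gurevich pressure P(φ) < ∞, and entropy at infinity h_∞ = 0. Then χ_per(φ) := sup{(1/n)S_nφ(x) : σ^n x = x, n ∈ ℕ} < P(φ) (condition (UCS)) holds if and only if φ is strongly positive recurrent. -/

import Mathlib

open Filter Set MeasureTheory Real ENNReal

namespace CMS

/-- Points of the full sequence space over the alphabet `ℕ`. -/
abbrev Pt : Type := ℕ → ℕ

/-- The (left) shift map `σ`. -/
def shiftMap : Pt → Pt := fun x i => x (i + 1)

/-- `x` is a point of the countable Markov shift `Σ` determined by the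
transition matrix `M` (identified with a relation on the alphabet `ℕ`). -/
def isAdmissible (M : ℕ → ℕ → Prop) (x : Pt) : Prop := ∀ i, M (x i) (x (i + 1))

/-- Topological transitivity: for all states `a, b` there is `N` with
`[a] ∩ σ⁻ᴺ [b] ≠ ∅`. -/
def TopTransitive (M : ℕ → ℕ → Prop) : Prop :=
  ∀ a b : ℕ, ∃ (N : ℕ) (x : Pt), isAdmissible M x ∧ x 0 = a ∧ x N = b

/-- Birkhoff sum `S_n φ`. -/
noncomputable def birkhoff (φ : Pt → ℝ) (n : ℕ) (x : Pt) : ℝ :=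
  ∑ i ∈ Finset.range n, φ (shiftMap^[i] x)

/-- `φ` has summable variations: `∑_{k ≥ 2} var_k(φ) < ∞`, expressed via a summable
sequence dominating the `k`-th variations. -/
def SummableVariations (M : ℕ → ℕ → Prop) (φ : Pt → ℝ) : Prop :=
  ∃ V : ℕ → ℝ, Summable V ∧
    ∀ k, 2 ≤ k → ∀ x y : Pt, isAdmissible M x → isAdmissible M y →
      (∀ i < k, x i = y i) → |φ x - φ y| ≤ V k

/-- `φ` is weakly Hölder continuous: `var_k(φ) ≤ C θ^k` for all `k ≥ 2`. -/
def WeaklyHolder (M : ℕ → ℕ → Prop) (φ : Pt → ℝ) : Prop :=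
  ∃ C θ : ℝ, 0 < C ∧ 0 < θ ∧ θ < 1 ∧
    ∀ k, 2 ≤ k → ∀ x y : Pt, isAdmissible M x → isAdmissible M y →
      (∀ i < k, x i = y i) → |φ x - φ y| ≤ C * θ ^ k

/-- Periodic points of period `n` in the 1-cylinder `[a]`. -/
def PerSet (M : ℕ → ℕ → Prop) (a n : ℕ) : Set Pt :=
  {x | isAdmissible M x ∧ shiftMap^[n] x = x ∧ x 0 = a}

/-- Periodic points of period `n` in `[a]` whose first return time to `[a]` is `n`. -/
def PerStarSet (M : ℕ → ℕ → Prop) (a n : ℕ) : Set Pt :=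
  {x | isAdmissible M x ∧ shiftMap^[n] x = x ∧ x 0 = a ∧ ∀ k, 0 < k → k < n → x k ≠ a}

/-- The Gurevich partition function `Z_n(φ, a)`. -/
noncomputable def Zn (M : ℕ → ℕ → Prop) (φ : Pt → ℝ) (a n : ℕ) : ℝ≥0∞ :=
  ∑' x : PerSet M a n, ENNReal.ofReal (Real.exp (birkhoff φ n x.1))

/-- The first-return partition function `Z_n^*(φ, a)`. -/
noncomputable def ZnStar (M : ℕ → ℕ → Prop) (φ : Pt → ℝ) (a n : ℕ) : ℝ≥0∞ :=
  ∑' x : PerStarSet M a n, ENNReal.ofReal (Real.exp (birkhoff φ n x.1))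

/-- The Gurevich pressure at the state `a`:
`P(φ) = limsup_n (1/n) log Z_n(φ, a)`, with values in `EReal`. -/
noncomputable def pressureAt (M : ℕ → ℕ → Prop) (φ : Pt → ℝ) (a : ℕ) : EReal :=
  Filter.limsup (fun n : ℕ => ((n : ℝ)⁻¹ : EReal) * ENNReal.log (Zn M φ a n)) atTop

/-- `limsup_n (1/n) log Z_n^*(φ, a)`, with values in `EReal`. -/
noncomputable def pressureStarAt (M : ℕ → ℕ → Prop) (φ : Pt → ℝ) (a : ℕ) : EReal :=
  Filter.limsup (fun n : ℕ => ((n : ℝ)⁻¹ : EReal) * ENNReal.log (ZnStar M φ a n)) atTop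

/-- Strong positive recurrence of `φ`, relative to the common value `P` of the
Gurevich pressure: for some state `a`, `limsup_n (1/n) log Z_n^*(φ,a) < P(φ)`. -/
def SPR (M : ℕ → ℕ → Prop) (φ : Pt → ℝ) (P : ℝ) : Prop :=
  ∃ a : ℕ, pressureStarAt M φ a < (P : EReal)

/-- The `F`-property: for every state `a` and every `n ≥ 1` there are only finitely
many periodic points of period `n` in `[a]`. -/
def FProperty (M : ℕ → ℕ → Prop) : Prop :=
  ∀ a n : ℕ, 0 < n → (PerSet M a n).Finite

/-- `χ_per(φ) = sup { (1/n) S_n φ(x) : σ^n x = x, n ∈ ℕ }`, with values in `EReal`. -/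
noncomputable def chiPer (M : ℕ → ℕ → Prop) (φ : Pt → ℝ) : EReal :=
  ⨆ p : {p : Pt × ℕ // isAdmissible M p.1 ∧ 0 < p.2 ∧ shiftMap^[p.2] p.1 = p.1},
    ((birkhoff φ p.1.2 p.1.1 / (p.1.2 : ℝ) : ℝ) : EReal)

/-- `x` lies in a cylinder belonging to `B(n, M', q)`: it is admissible,
`x 0 ≤ q`, `x n ≤ q` and `#{0 ≤ k ≤ n : x k ≤ q} ≤ (n+1)/M'`. -/
def inBSet (M : ℕ → ℕ → Prop) (n M' q : ℕ) (x : Pt) : Prop :=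
  isAdmissible M x ∧ x 0 ≤ q ∧ x n ≤ q ∧
    ((((Finset.range (n + 1)).filter (fun k => x k ≤ q)).card : ℝ) ≤ (n + 1 : ℝ) / (M' : ℝ))

/-- `z_{φ,n}(M',q) = sup { (1/n) S_n φ(x) : x ∈ B for some B ∈ B(n,M',q) }`. -/
noncomputable def zPhi (M : ℕ → ℕ → Prop) (φ : Pt → ℝ) (n M' q : ℕ) : EReal :=
  ⨆ x : {x : Pt // inBSet M n M' q x}, ((birkhoff φ n x.1 / (n : ℝ) : ℝ) : EReal)

/-- The contraction at infinity
`δ_{φ,∞} = lim_{q→∞} lim_{M'→∞} limsup_{n→∞} z_{φ,n}(M',q)`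
(the inner limits exist by monotonicity, so they agree with `liminf`s). -/
noncomputable def deltaInf (M : ℕ → ℕ → Prop) (φ : Pt → ℝ) : EReal :=
  liminf (fun q : ℕ => liminf (fun M' : ℕ =>
    limsup (fun n : ℕ => zPhi M φ n M' q) atTop) atTop) atTop

/-- `z_n(M',q) = #B(n,M',q)`, the number of `(n+1)`-cylinders (i.e. admissible
words realized in `Σ`) in `B(n,M',q)`, counted in `ℝ≥0∞`. -/
noncomputable def zCount (M : ℕ → ℕ → Prop) (n M' q : ℕ) : ℝ≥0∞ :=
  ∑' _w : {w : Fin (n + 1) → ℕ //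
      (∃ x : Pt, isAdmissible M x ∧ ∀ i : Fin (n + 1), x (i : ℕ) = w i) ∧
      w 0 ≤ q ∧ w (Fin.last n) ≤ q ∧
      (((Finset.univ.filter (fun i : Fin (n + 1) => w i ≤ q)).card : ℝ) ≤ (n + 1 : ℝ) / (M' : ℝ))},
    (1 : ℝ≥0∞)

/-- The entropy at infinity
`h_∞ = lim_{q→∞} lim_{M'→∞} limsup_{n→∞} (1/n) log z_n(M',q)`. -/
noncomputable def hInfty (M : ℕ → ℕ → Prop) : EReal :=
  liminf (fun q : ℕ => liminf (fun M' : ℕ =>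
    limsup (fun n : ℕ => ((n : ℝ)⁻¹ : EReal) * ENNReal.log (zCount M n M' q)) atTop) atTop) atTop

end CMS

open CMS


namespace CMS

/-! ### Periodic points spelled by finite words -/

/-- The periodic point obtained by repeating the word `W`. -/
def per (W : List ℕ) : Pt := fun i => W.getD (i % W.length) 0

/-- The word formed by the first `n` symbols of `x`. -/
def pre (x : Pt) (n : ℕ) : List ℕ := (List.range n).map x

@[simp] lemma length_pre (x : Pt) (n : ℕ) : (pre x n).length = n := by simp [pre]

lemma pre_getD {x : Pt} {n i : ℕ} (h : i < n) : (pre x n).getD i 0 = x i := by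
  simp [pre, h]

lemma pre_succ_eq_cons (x : Pt) (n : ℕ) : pre x (n + 1) = x 0 :: pre (shiftMap x) n := by
  simp [pre, List.range_succ_eq_map, shiftMap, Function.comp_def]

lemma pre_succ_eq_append (x : Pt) (n : ℕ) : pre x (n + 1) = pre x n ++ [x n] := by
  simp [pre, List.range_succ]

lemma mem_pre {x : Pt} {n c : ℕ} : c ∈ pre x n ↔ ∃ k < n, x k = c := by
  simp [pre]

lemma shiftMap_iterate (k : ℕ) (x : Pt) (i : ℕ) : shiftMap^[k] x i = x (i + k) := by
  induction k generalizing i with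
  | zero => rfl
  | succ k ih => rw [Function.iterate_succ_apply', shiftMap, ih]; congr 1; omega

lemma isAdmissible.shift {M : ℕ → ℕ → Prop} {x : Pt} (h : isAdmissible M x) (k : ℕ) :
    isAdmissible M (shiftMap^[k] x) := by
  intro i
  rw [shiftMap_iterate, shiftMap_iterate]
  convert h (i + k) using 2; omega

lemma apply_add_mul_of_iterate_eq {x : Pt} {n : ℕ} (h : shiftMap^[n] x = x) (i j : ℕ) :
    x (i + j * n) = x i := by
  induction j with
  | zero => simp
  | succ j ih =>
    rw [← ih, ← congrFun h (i + j * n), shiftMap_iterate]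
    congr 1; ring

lemma isChain_pre {M : ℕ → ℕ → Prop} {x : Pt} (h : isAdmissible M x) (n : ℕ) :
    (pre x n).IsChain M := by
  rw [List.isChain_iff_getElem]
  intro i hi
  simpa [pre] using h i

lemma per_of_lt {W : List ℕ} {i : ℕ} (h : i < W.length) : per W i = W.getD i 0 := by
  rw [per, Nat.mod_eq_of_lt h]

lemma per_zero_cons (b : ℕ) (t : List ℕ) : per (b :: t) 0 = b := by
  rw [per_of_lt (by simp)]; simp

lemma shiftMap_iterate_length_per (W : List ℕ) : shiftMap^[W.length] (per W) = per W := by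
  funext i
  rw [shiftMap_iterate, per, per, Nat.add_mod_right]

lemma shiftMap_iterate_per_append (U V : List ℕ) :
    shiftMap^[U.length] (per (U ++ V)) = per (V ++ U) := by
  funext i
  rw [shiftMap_iterate, per, per]
  have hl : (V ++ U).length = (U ++ V).length := by simp [add_comm]
  rw [hl]
  set L := (U ++ V).length with hL
  have hL' : L = U.length + V.length := by simp [hL]
  rcases Nat.eq_zero_or_pos L with h0 | hpos
  · have hU : U = [] := List.eq_nil_of_length_eq_zero (by omega)
    have hV : V = [] := List.eq_nil_of_length_eq_zero (by omega)
    simp [hU, hV]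
  have hr : i % L < L := Nat.mod_lt _ hpos
  have : (i + U.length) % L = (i % L + U.length) % L := by rw [Nat.mod_add_mod]
  rw [this]
  generalize i % L = r at hr
  by_cases hrV : r < V.length
  · rw [Nat.mod_eq_of_lt (by omega), List.getD_append_right _ _ _ _ (by omega),
      List.getD_append _ _ _ _ hrV]
    congr 1; omega
  · rw [Nat.mod_eq_sub_mod (by omega), Nat.mod_eq_of_lt (by omega),
      List.getD_append _ _ _ _ (by omega), List.getD_append_right _ _ _ _ (by omega)]
    congr 1; omega

lemma per_pre {x : Pt} {n : ℕ} (hn : 0 < n) (h : shiftMap^[n] x = x) : per (pre x n) = x := by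
  funext i
  have hr : i % n < n := Nat.mod_lt _ hn
  rw [per, length_pre, pre_getD hr, ← apply_add_mul_of_iterate_eq h (i % n) (i / n)]
  congr 1; rw [mul_comm]; exact Nat.mod_add_div i n

lemma per_injOn_length {W W' : List ℕ} (hl : W.length = W'.length) (h : per W = per W') :
    W = W' := by
  refine List.ext_getElem hl fun i h1 h2 => ?_
  have := congrFun h i
  rw [per_of_lt h1, per_of_lt h2] at this
  simpa [h1, h2] using this

lemma isAdmissible_per {M : ℕ → ℕ → Prop} {b : ℕ} {t : List ℕ}
    (h : (b :: t ++ [b]).IsChain M) : isAdmissible M (per (b :: t)) := by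
  intro i
  rw [List.isChain_iff_getElem] at h
  set L := (b :: t).length with hL
  have hpos : 0 < L := by simp [hL]
  have hr : i % L < L := Nat.mod_lt _ hpos
  have hi := h (i % L) (by simp [hL] at hr ⊢; omega)
  have e0 : per (b :: t) i = (b :: t ++ [b])[i % L]'(by simp [hL] at hr ⊢; omega) := by
    rw [per, ← hL, List.getElem_append_left hr]
    simp only [List.getD_eq_getElem?_getD, List.getElem?_eq_getElem hr, Option.getD_some]
  have e1 : per (b :: t) (i + 1) =
      (b :: t ++ [b])[i % L + 1]'(by simp [hL] at hr ⊢; omega) := by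
    rw [per, ← hL]
    have : (i + 1) % L = (i % L + 1) % L := by rw [Nat.mod_add_mod]
    rw [this]
    rcases Nat.lt_or_ge (i % L + 1) L with hlt | hge
    · rw [Nat.mod_eq_of_lt hlt, List.getElem_append_left hlt]
      simp only [List.getD_eq_getElem?_getD, List.getElem?_eq_getElem hlt, Option.getD_some]
    · have : i % L + 1 = L := by omega
      have key : ∀ (j : ℕ) (hj : j < (b :: t ++ [b]).length), j = L →
          (b :: t ++ [b])[j] = b := by
        rintro j hj rfl
        rw [List.getElem_append_right hL.ge]
        simp
      rw [key _ _ this, this, Nat.mod_self]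
      simp
  rw [e0, e1]; exact hi

/-! ### Bounded distortion of Birkhoff sums -/

lemma birkhoff_add (φ : Pt → ℝ) (m n : ℕ) (x : Pt) :
    birkhoff φ (m + n) x = birkhoff φ m x + birkhoff φ n (shiftMap^[m] x) :=
  birkhoffSum_add shiftMap φ m n x

lemma birkhoff_iterate_of_periodic (φ : Pt → ℝ) {n : ℕ} {x : Pt} (h : shiftMap^[n] x = x)
    (k : ℕ) : birkhoff φ n (shiftMap^[k] x) = birkhoff φ n x := by
  have h1 := birkhoff_add φ k n x
  have h2 := birkhoff_add φ n k x
  rw [h] at h2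
  rw [add_comm n k] at h2
  linarith

lemma birkhoff_mul_of_periodic (φ : Pt → ℝ) {n : ℕ} {x : Pt} (h : shiftMap^[n] x = x)
    (j : ℕ) : birkhoff φ (j * n) x = j * birkhoff φ n x := by
  induction j with
  | zero => simp [birkhoff]
  | succ j ih =>
    rw [add_mul, one_mul, add_comm, birkhoff_add, h, ih]; push_cast; ring

/-- `C` bounds the distortion of all Birkhoff sums of `φ` along cylinders. -/
def DistortionBound (M : ℕ → ℕ → Prop) (φ : Pt → ℝ) (C : ℝ) : Prop :=
  ∀ (n : ℕ) (x y : Pt), isAdmissible M x → isAdmissible M y → (∀ i ≤ n, x i = y i) →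
    |birkhoff φ n x - birkhoff φ n y| ≤ C

lemma SummableVariations.exists_distortionBound {M : ℕ → ℕ → Prop} {φ : Pt → ℝ}
    (h : SummableVariations M φ) : ∃ C, 0 ≤ C ∧ DistortionBound M φ C := by
  obtain ⟨V, hV, hvar⟩ := h
  refine ⟨∑' k, |V k|, tsum_nonneg fun _ => abs_nonneg _, fun n x y hx hy hxy => ?_⟩
  rw [birkhoff, birkhoff, ← Finset.sum_sub_distrib]
  have hterm : ∀ i ∈ Finset.range n,
      |φ (shiftMap^[i] x) - φ (shiftMap^[i] y)| ≤ |V (n + 1 - i)| := by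
    intro i hi
    have hi := Finset.mem_range.1 hi
    refine (hvar (n + 1 - i) (by omega) _ _ (hx.shift i) (hy.shift i) fun k hk => ?_).trans
      (le_abs_self _)
    rw [shiftMap_iterate, shiftMap_iterate]
    exact hxy _ (by omega)
  calc _ ≤ ∑ i ∈ Finset.range n, |V (n + 1 - i)| :=
        (Finset.abs_sum_le_sum_abs _ _).trans (Finset.sum_le_sum hterm)
    _ = ∑ k ∈ (Finset.range n).image (fun i => n + 1 - i), |V k| := by
        rw [Finset.sum_image]
        intro i hi j hj hij
        simp only [Finset.coe_range, Set.mem_Iio] at hi hj hij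
        omega
    _ ≤ _ := hV.abs.sum_le_tsum _ fun _ _ => abs_nonneg _

/-! ### The alphabet of first-return loops -/

/-- First-return loops at `b`, with the initial symbol `b` stripped. -/
abbrev Loop (M : ℕ → ℕ → Prop) (b : ℕ) : Type :=
  {l : List ℕ // b ∉ l ∧ (b :: l ++ [b]).IsChain M}

variable {M : ℕ → ℕ → Prop} {φ : Pt → ℝ} {a b : ℕ}

/-- The word in the original alphabet spelled by a list of loops at `b`. -/
def word (ls : List (Loop M b)) : List ℕ := ls.flatMap fun l => b :: l.1

@[simp] lemma word_nil : word ([] : List (Loop M b)) = [] := rfl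

@[simp] lemma word_cons (l : Loop M b) (ls : List (Loop M b)) :
    word (l :: ls) = b :: l.1 ++ word ls := by simp [word]

@[simp] lemma word_append (u v : List (Loop M b)) : word (u ++ v) = word u ++ word v := by
  simp [word]

lemma exists_word_append_singleton (ls : List (Loop M b)) : ∃ t, word ls ++ [b] = b :: t := by
  cases ls <;> simp

lemma isChain_word (ls : List (Loop M b)) : (word ls ++ [b]).IsChain M := by
  induction ls with
  | nil => simp
  | cons l ls ih =>
    obtain ⟨t, ht⟩ := exists_word_append_singleton ls
    rw [word_cons, List.append_assoc, ht]
    rw [ht] at ih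
    exact List.isChain_split.2 ⟨l.2.2, ih⟩

lemma isAdmissible_per_word {ls : List (Loop M b)} (h : ls ≠ []) :
    isAdmissible M (per (word ls)) := by
  obtain ⟨l, ls, rfl⟩ := List.exists_cons_of_ne_nil h
  have := isChain_word (l :: ls)
  rw [word_cons] at this ⊢
  exact isAdmissible_per this

lemma per_word_zero {ls : List (Loop M b)} (h : ls ≠ []) : per (word ls) 0 = b := by
  obtain ⟨l, ls, rfl⟩ := List.exists_cons_of_ne_nil h
  rw [word_cons]; exact per_zero_cons _ _

lemma length_word_pos {ls : List (Loop M b)} (h : ls ≠ []) : 0 < (word ls).length := by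
  obtain ⟨l, ls, rfl⟩ := List.exists_cons_of_ne_nil h
  simp

lemma count_word (ls : List (Loop M b)) : (word ls).count b = ls.length := by
  induction ls with
  | nil => simp
  | cons l ls ih => simp [ih, List.count_eq_zero_of_not_mem l.2.1, add_comm]

lemma word_injective : Function.Injective (word : List (Loop M b) → List ℕ) := by
  have key : ∀ (l : Loop M b) (ls : List (Loop M b)),
      (l.1 ++ word ls).takeWhile (fun c => c ≠ b) = l.1 := by
    intro l ls
    rw [List.takeWhile_append_of_pos]
    · cases ls <;> simp
    · intro c hc
      simpa using fun h : c = b => l.2.1 (h ▸ hc)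
  intro u
  induction u with
  | nil =>
    intro v h
    cases v with
    | nil => rfl
    | cons l ls => simp at h
  | cons l ls ih =>
    intro v h
    cases v with
    | nil => simp at h
    | cons l' ls' =>
      have hword : l.1 ++ word ls = l'.1 ++ word ls' := by simpa using h
      have hl : l.1 = l'.1 := by rw [← key l ls, hword, key]
      rw [hl] at hword
      rw [Subtype.ext hl, ih (List.append_cancel_left hword)]

/-- Every closed path at `b` is a concatenation of first-return loops. -/
lemma exists_word_eq (t : List ℕ) (h : (b :: t ++ [b]).IsChain M) :
    ∃ (l : Loop M b) (ls : List (Loop M b)), word (l :: ls) = b :: t := by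
  induction hn : t.length using Nat.strong_induction_on generalizing t with
  | _ n ih =>
    by_cases hb : b ∈ t
    · obtain ⟨p, s, rfl, hp⟩ := List.eq_append_cons_of_mem hb
      have h' : (b :: p ++ b :: (s ++ [b])).IsChain M := by simpa using h
      obtain ⟨h1, h2⟩ := List.isChain_split.1 h'
      obtain ⟨l, ls, hls⟩ := ih s.length (by simp at hn; omega) s (by simpa using h2) rfl
      exact ⟨⟨p, hp, h1⟩, l :: ls, by rw [word_cons, hls]; simp⟩
    · exact ⟨⟨t, hb, h⟩, [], by simp⟩

lemma mem_word {ls : List (Loop M b)} {c : ℕ} (hc : c ≠ b) (h : c ∈ word ls) :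
    ∃ l ∈ ls, c ∈ l.1 := by
  simpa [word, hc] using h

lemma mem_word_of_mem {ls : List (Loop M b)} {l : Loop M b} (hl : l ∈ ls) {c : ℕ}
    (h : c ∈ l.1) : c ∈ word ls := by
  simp only [word, List.mem_flatMap]
  exact ⟨l, hl, by simp [h]⟩

/-- `S_n φ - t n` along the periodic point spelled by a list of loops at `b`. -/
noncomputable def wt (φ : Pt → ℝ) (t : ℝ) (ls : List (Loop M b)) : ℝ :=
  birkhoff φ (word ls).length (per (word ls)) - t * (word ls).length

lemma wt_append {C : ℝ} (hC0 : 0 ≤ C) (hC : DistortionBound M φ C) (t : ℝ)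
    (u v : List (Loop M b)) : |wt φ t (u ++ v) - wt φ t u - wt φ t v| ≤ 2 * C := by
  rcases eq_or_ne u [] with rfl | hu
  · simpa [wt, birkhoff] using hC0
  rcases eq_or_ne v [] with rfl | hv
  · simpa [wt, birkhoff] using hC0
  have agree : ∀ u v : List (Loop M b), u ≠ [] → v ≠ [] → ∀ i ≤ (word u).length,
      per (word (u ++ v)) i = per (word u) i := by
    intro u v hu hv i hi
    rcases hi.lt_or_eq with hlt | rfl
    · rw [word_append, per_of_lt (by simp; omega), per_of_lt hlt, List.getD_append _ _ _ _ hlt]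
    · have h1 := congrFun (shiftMap_iterate_per_append (word u) (word v)) 0
      have h2 := congrFun (shiftMap_iterate_length_per (word u)) 0
      rw [shiftMap_iterate, zero_add] at h1 h2
      rw [word_append, h1, h2, ← word_append, per_word_zero (by simp [hu]), per_word_zero hu]
  have h1 := hC _ _ _ (isAdmissible_per_word (by simp [hu])) (isAdmissible_per_word hu)
    (agree u v hu hv)
  have h2 := hC _ _ _ (isAdmissible_per_word (by simp [hv])) (isAdmissible_per_word hv)
    (agree v u hv hu)
  have h3 : birkhoff φ (word (u ++ v)).length (per (word (u ++ v))) =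
      birkhoff φ (word u).length (per (word (u ++ v))) +
        birkhoff φ (word v).length (per (word (v ++ u))) := by
    rw [word_append, word_append, List.length_append, birkhoff_add, shiftMap_iterate_per_append]
  have h4 : ((word (u ++ v)).length : ℝ) = (word u).length + (word v).length := by simp
  rw [wt, wt, wt, h3, h4]
  rw [abs_le] at h1 h2 ⊢
  constructor <;> linarith [h1.1, h1.2, h2.1, h2.2]

/-! ### Total mass of the loops extending a given list of loops -/

lemma tsum_list {α : Type*} (f : List α → ℝ≥0∞) :
    ∑' w, f w = f [] + ∑' x, ∑' w, f (x :: w) := by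
  let e : Unit ⊕ α × List α ≃ List α :=
    { toFun := Sum.elim (fun _ => []) fun p => p.1 :: p.2
      invFun := fun w => match w with
        | [] => Sum.inl ()
        | x :: w => Sum.inr (x, w)
      left_inv := by rintro (_ | ⟨x, w⟩) <;> rfl
      right_inv := by rintro (_ | ⟨x, w⟩) <;> rfl }
  rw [← e.tsum_eq, Summable.tsum_sum ENNReal.summable ENNReal.summable]
  congr 1
  · simp [e]
  · exact ENNReal.tsum_prod (f := fun x w => f (x :: w))

/-- The sum of `exp (S_n φ - t n)` over all lists of loops extending `v`. -/
noncomputable def mass (φ : Pt → ℝ) (t : ℝ) (v : List (Loop M b)) : ℝ≥0∞ :=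
  ∑' w : List (Loop M b), ENNReal.ofReal (Real.exp (wt φ t (v ++ w)))

lemma le_mass (φ : Pt → ℝ) (t : ℝ) (v : List (Loop M b)) :
    ENNReal.ofReal (Real.exp (wt φ t v)) ≤ mass φ t v := by
  rw [mass, tsum_list, List.append_nil]
  exact le_self_add

lemma tsum_mass_le (φ : Pt → ℝ) (t : ℝ) (v : List (Loop M b)) :
    ∑' x, mass φ t (v ++ [x]) ≤ mass φ t v := by
  conv_rhs => rw [mass, tsum_list]
  simp only [mass, List.append_assoc, List.singleton_append]
  exact le_add_self

lemma mul_mass_le {t K : ℝ} {v v' : List (Loop M b)}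
    (h : ∀ w, K + wt φ t (v ++ w) ≤ wt φ t (v' ++ w)) :
    ENNReal.ofReal (Real.exp K) * mass φ t v ≤ mass φ t v' := by
  rw [mass, mass, ← ENNReal.tsum_mul_left]
  refine ENNReal.tsum_le_tsum fun w => ?_
  rw [← ENNReal.ofReal_mul (Real.exp_pos _).le, ← Real.exp_add]
  exact ENNReal.ofReal_le_ofReal (Real.exp_le_exp.2 (h w))

lemma mul_mass_le_mass_append {C : ℝ} (hC0 : 0 ≤ C) (hC : DistortionBound M φ C) (t : ℝ)
    (v : List (Loop M b)) (u : Loop M b) :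
    ENNReal.ofReal (Real.exp (wt φ t [u] - 6 * C)) * mass φ t v ≤ mass φ t (v ++ [u]) := by
  refine mul_mass_le fun w => ?_
  have h1 := abs_le.1 (wt_append hC0 hC t v w)
  have h2 := abs_le.1 (wt_append hC0 hC t (v ++ [u]) w)
  have h3 := abs_le.1 (wt_append hC0 hC t v [u])
  linarith [h1.2, h2.1, h3.1]

lemma mul_mass_append_le_mass_append {C : ℝ} (hC0 : 0 ≤ C) (hC : DistortionBound M φ C) (t : ℝ)
    (v : List (Loop M b)) (x y : Loop M b) :
    ENNReal.ofReal (Real.exp (wt φ t [y] - wt φ t [x] - 8 * C)) * mass φ t (v ++ [x]) ≤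
      mass φ t (v ++ [y]) := by
  refine mul_mass_le fun w => ?_
  have h1 := abs_le.1 (wt_append hC0 hC t v [x])
  have h2 := abs_le.1 (wt_append hC0 hC t (v ++ [x]) w)
  have h3 := abs_le.1 (wt_append hC0 hC t v [y])
  have h4 := abs_le.1 (wt_append hC0 hC t (v ++ [y]) w)
  linarith [h1.2, h2.2, h3.1, h4.1]

/-- If every loop can be exchanged for a different one at bounded cost, then the mass above a list
of loops decays exponentially with the number of loops. -/
lemma pow_mul_mass_le {C : ℝ} (hC0 : 0 ≤ C) (hC : DistortionBound M φ C) {t κ : ℝ}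
    (h : ∀ x : Loop M b, ∃ y, y ≠ x ∧ κ ≤ wt φ t [y] - wt φ t [x] - 8 * C)
    (v w : List (Loop M b)) :
    (1 + ENNReal.ofReal (Real.exp κ)) ^ w.length * mass φ t (v ++ w) ≤ mass φ t v := by
  induction w generalizing v with
  | nil => simp
  | cons x w ih =>
    obtain ⟨y, hyx, hy⟩ := h x
    calc _ = (1 + ENNReal.ofReal (Real.exp κ)) *
          ((1 + ENNReal.ofReal (Real.exp κ)) ^ w.length * mass φ t ((v ++ [x]) ++ w)) := by
          rw [List.length_cons, pow_succ']; simp [mul_assoc]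
      _ ≤ (1 + ENNReal.ofReal (Real.exp κ)) * mass φ t (v ++ [x]) := by gcongr; exact ih _
      _ = mass φ t (v ++ [x]) + ENNReal.ofReal (Real.exp κ) * mass φ t (v ++ [x]) := by ring
      _ ≤ mass φ t (v ++ [x]) + mass φ t (v ++ [y]) := by
          gcongr
          refine le_trans ?_ (mul_mass_append_le_mass_append hC0 hC t v x y)
          gcongr
      _ = ∑ z ∈ ({x, y} : Finset (Loop M b)), mass φ t (v ++ [z]) := by
          rw [Finset.sum_pair hyx.symm]
      _ ≤ ∑' z, mass φ t (v ++ [z]) := ENNReal.sum_le_tsum _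
      _ ≤ mass φ t v := tsum_mass_le φ t v

open scoped Classical in
/-- The part of `mass φ t v` carried by the extensions whose first `r` loops lie in `S`. -/
noncomputable def massOn (φ : Pt → ℝ) (t : ℝ) (S : Set (Loop M b)) (r : ℕ)
    (v : List (Loop M b)) : ℝ≥0∞ :=
  ∑' w : List (Loop M b), if r ≤ w.length ∧ ∀ x ∈ w.take r, x ∈ S then
    ENNReal.ofReal (Real.exp (wt φ t (v ++ w))) else 0

open scoped Classical in
lemma massOn_succ (φ : Pt → ℝ) (t : ℝ) (S : Set (Loop M b)) (r : ℕ) (v : List (Loop M b)) :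
    massOn φ t S (r + 1) v = ∑' x, if x ∈ S then massOn φ t S r (v ++ [x]) else 0 := by
  rw [massOn, tsum_list]
  simp only [List.length_nil, Nat.le_zero_eq, List.length_cons, List.take_succ_cons,
    List.mem_cons, forall_eq_or_imp, Nat.add_le_add_iff_right]
  rw [if_neg (by simp), zero_add]
  refine tsum_congr fun x => ?_
  by_cases hx : x ∈ S <;> simp [hx, massOn]

/-- If some loop `u` is not in `S`, then the mass of lists whose first `r` loops lie in `S` decays
exponentially with `r`. -/
lemma pow_mul_massOn_le {C : ℝ} (hC0 : 0 ≤ C) (hC : DistortionBound M φ C) {t κ : ℝ}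
    {S : Set (Loop M b)} {u : Loop M b} (hu : u ∉ S) (hκ : κ ≤ wt φ t [u] - 6 * C)
    (r : ℕ) (v : List (Loop M b)) :
    (1 + ENNReal.ofReal (Real.exp κ)) ^ r * massOn φ t S r v ≤ mass φ t v := by
  classical
  induction r generalizing v with
  | zero => simp [massOn, mass]
  | succ r ih =>
    have hS : ∑' x, (if x ∈ S then mass φ t (v ++ [x]) else 0) ≤ mass φ t v :=
      le_trans (ENNReal.tsum_le_tsum fun x => by split_ifs <;> simp) (tsum_mass_le φ t v)
    calc _ = (1 + ENNReal.ofReal (Real.exp κ)) * ∑' x, if x ∈ S then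
            (1 + ENNReal.ofReal (Real.exp κ)) ^ r * massOn φ t S r (v ++ [x]) else 0 := by
          rw [pow_succ', mul_assoc, massOn_succ, ← ENNReal.tsum_mul_left]
          simp
      _ ≤ (1 + ENNReal.ofReal (Real.exp κ)) *
            ∑' x, if x ∈ S then mass φ t (v ++ [x]) else 0 := by
          gcongr with x
          split_ifs
          exacts [ih _, le_rfl]
      _ = ∑' x, (if x ∈ S then mass φ t (v ++ [x]) else 0) + ENNReal.ofReal (Real.exp κ) *
            ∑' x, if x ∈ S then mass φ t (v ++ [x]) else 0 := by ring
      _ ≤ ∑' x, (if x ∈ S then mass φ t (v ++ [x]) else 0) + mass φ t (v ++ [u]) := by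
          gcongr
          refine le_trans ?_ (mul_mass_le_mass_append hC0 hC t v u)
          gcongr
      _ = ∑' x, ((if x ∈ S then mass φ t (v ++ [x]) else 0) +
            if x = u then mass φ t (v ++ [x]) else 0) := by
          rw [ENNReal.tsum_add, tsum_ite_eq u (fun x => mass φ t (v ++ [x]))]
      _ ≤ ∑' x, mass φ t (v ++ [x]) := by
          refine ENNReal.tsum_le_tsum fun x => ?_
          rcases eq_or_ne x u with rfl | hx
          · simp [hu]
          · simp only [hx, if_false, add_zero]; split_ifs <;> simp
      _ ≤ mass φ t v := tsum_mass_le φ t v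

/-! ### Exponential growth rates -/

/-- `f` grows at an exponential rate strictly below `P`. -/
def RateLT (f : ℕ → ℝ≥0∞) (P : ℝ) : Prop :=
  ∃ ρ < P, ∀ᶠ n : ℕ in atTop, f n ≤ ENNReal.ofReal (Real.exp (ρ * n))

lemma inv_mul_log_le_iff {x : ℝ≥0∞} {n : ℕ} (hn : 0 < n) (ρ : ℝ) :
    ((n : ℝ)⁻¹ : EReal) * ENNReal.log x ≤ ρ ↔ x ≤ ENNReal.ofReal (Real.exp (ρ * n)) := by
  have hn' : (0 : ℝ) < n := by exact_mod_cast hn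
  rw [← EReal.div_eq_inv_mul, EReal.div_le_iff_le_mul (by exact_mod_cast hn') (EReal.coe_ne_top _),
    ← EReal.coe_mul, mul_comm, ← EReal.log_exp ((ρ * n : ℝ) : EReal), ENNReal.log_le_log_iff,
    EReal.exp_coe]

lemma limsup_lt_iff_rateLT {f : ℕ → ℝ≥0∞} {P : ℝ} :
    limsup (fun n : ℕ => ((n : ℝ)⁻¹ : EReal) * ENNReal.log (f n)) atTop < (P : EReal) ↔
      RateLT f P := by
  constructor
  · intro h
    obtain ⟨ρ, h1, h2⟩ := EReal.lt_iff_exists_real_btwn.1 h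
    refine ⟨ρ, EReal.coe_lt_coe_iff.1 h2, ?_⟩
    filter_upwards [eventually_lt_of_limsup_lt h1, eventually_gt_atTop 0] with n hn hn0
    exact (inv_mul_log_le_iff hn0 ρ).1 hn.le
  · rintro ⟨ρ, hρ, h⟩
    refine lt_of_le_of_lt (limsup_le_of_le (a := (ρ : EReal)) (by isBoundedDefault) ?_)
      (EReal.coe_lt_coe_iff.2 hρ)
    filter_upwards [h, eventually_gt_atTop 0] with n hn hn0
    exact (inv_mul_log_le_iff hn0 ρ).2 hn

lemma RateLT.of_le_exp {f : ℕ → ℝ≥0∞} {P K ρ : ℝ} (hρ : ρ < P)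
    (h : ∀ᶠ n : ℕ in atTop, f n ≤ ENNReal.ofReal (Real.exp (K + ρ * n))) : RateLT f P := by
  refine ⟨(ρ + P) / 2, by linarith, ?_⟩
  have hlim : Tendsto (fun n : ℕ => (P - ρ) / 2 * (n : ℝ)) atTop atTop :=
    tendsto_natCast_atTop_atTop.const_mul_atTop (by linarith)
  filter_upwards [h, hlim.eventually_ge_atTop K] with n hn hK
  refine hn.trans (ENNReal.ofReal_le_ofReal (Real.exp_le_exp.2 ?_))
  linarith

lemma RateLT.add {f g : ℕ → ℝ≥0∞} {P : ℝ} (hf : RateLT f P) (hg : RateLT g P) :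
    RateLT (fun n => f n + g n) P := by
  obtain ⟨ρ, hρ, hf⟩ := hf
  obtain ⟨ρ', hρ', hg⟩ := hg
  refine RateLT.of_le_exp (K := Real.log 2) (ρ := max ρ ρ') (max_lt hρ hρ') ?_
  filter_upwards [hf, hg] with n h1 h2
  have hn : (0 : ℝ) ≤ n := n.cast_nonneg
  refine (add_le_add h1 h2).trans ?_
  rw [← ENNReal.ofReal_add (Real.exp_pos _).le (Real.exp_pos _).le, Real.exp_add,
    Real.exp_log two_pos, two_mul]
  gcongr
  exacts [le_max_left _ _, le_max_right _ _]

lemma RateLT.sum {ι : Type*} {f : ι → ℕ → ℝ≥0∞} {P : ℝ} (s : Finset ι)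
    (h : ∀ i ∈ s, RateLT (f i) P) : RateLT (fun n => ∑ i ∈ s, f i n) P := by
  classical
  induction s using Finset.induction_on with
  | empty => exact ⟨P - 1, by linarith, by simp⟩
  | insert i s hi ih =>
    simp only [Finset.sum_insert hi]
    exact (h i (by simp)).add (ih fun j hj => h j (by simp [hj]))

lemma RateLT.mono {f g : ℕ → ℝ≥0∞} {P : ℝ} (hg : RateLT g P) (h : ∀ᶠ n in atTop, f n ≤ g n) :
    RateLT f P := by
  obtain ⟨ρ, hρ, hg⟩ := hg
  refine ⟨ρ, hρ, ?_⟩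
  filter_upwards [h, hg] with n h1 h2 using h1.trans h2

/-- A sequence of finite numbers growing at rate less than `P` is bounded by an exponential for all
positive indices. -/
lemma RateLT.exists_forall_le {f : ℕ → ℝ≥0∞} {P : ℝ} (hf : RateLT f P)
    (hfin : ∀ n, 0 < n → f n ≠ ∞) :
    ∃ ρ < P, ∃ K : ℝ, ∀ n, 0 < n → f n ≤ ENNReal.ofReal (Real.exp (K + ρ * n)) := by
  obtain ⟨ρ, hρ, hf⟩ := hf
  obtain ⟨N, hN⟩ := eventually_atTop.1 hf
  have hK : ∀ n : ℕ, ∃ K : ℝ, 0 ≤ K ∧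
      (0 < n → f n ≤ ENNReal.ofReal (Real.exp (K + ρ * n))) := by
    intro n
    refine ⟨max 0 (Real.log (f n).toReal - ρ * n), le_max_left _ _, fun hn => ?_⟩
    rw [← ENNReal.ofReal_toReal (hfin n hn)]
    refine ENNReal.ofReal_le_ofReal ?_
    rw [ENNReal.toReal_ofReal ENNReal.toReal_nonneg]
    calc (f n).toReal ≤ Real.exp (Real.log (f n).toReal) := Real.le_exp_log _
      _ ≤ _ := Real.exp_le_exp.2 (by linarith [le_max_right 0 (Real.log (f n).toReal - ρ * n)])
  choose K hK0 hK using hK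
  refine ⟨ρ, hρ, ∑ n ∈ Finset.range N, K n, fun n hn => ?_⟩
  have h0 : 0 ≤ ∑ n ∈ Finset.range N, K n := Finset.sum_nonneg fun n _ => hK0 n
  rcases lt_or_ge n N with h | h
  · refine (hK n hn).trans (ENNReal.ofReal_le_ofReal (Real.exp_le_exp.2 ?_))
    have := Finset.single_le_sum (f := K) (fun n _ => hK0 n) (Finset.mem_range.2 h)
    linarith
  · refine (hN n h).trans (ENNReal.ofReal_le_ofReal (Real.exp_le_exp.2 ?_))
    linarith

/-! ### Consequences of transitivity and of the `F`-property -/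

lemma FProperty.finite_perStarSet (hF : FProperty M) {n : ℕ} (hn : 0 < n) :
    (PerStarSet M a n).Finite :=
  (hF a n hn).subset fun _ hx => ⟨hx.1, hx.2.1, hx.2.2.1⟩

lemma tsum_ofReal_ne_top_of_finite {α : Type*} {s : Set α} (hs : s.Finite) (f : α → ℝ) :
    ∑' x : s, ENNReal.ofReal (f x) ≠ ∞ := by
  have := hs.fintype
  rw [tsum_fintype]
  exact (ENNReal.sum_lt_top.2 fun _ _ => ENNReal.ofReal_lt_top).ne

lemma isChain_append_pre {x : Pt} (hx : isAdmissible M x) {U : List ℕ}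
    (hU : (U ++ [x 0]).IsChain M) (n : ℕ) : (U ++ pre x n ++ [x n]).IsChain M := by
  rw [List.append_assoc, ← pre_succ_eq_append, pre_succ_eq_cons]
  refine List.isChain_split.2 ⟨hU, ?_⟩
  rw [← pre_succ_eq_cons]
  exact isChain_pre hx _

lemma exists_word_eq_of_getD {W : List ℕ} (hW : W ≠ []) (h0 : W.getD 0 0 = b)
    (h : (W ++ [b]).IsChain M) : ∃ ls : List (Loop M b), ls ≠ [] ∧ word ls = W := by
  obtain ⟨c, t, rfl⟩ := List.exists_cons_of_ne_nil hW
  obtain rfl : c = b := by simpa using h0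
  obtain ⟨l, ls, hls⟩ := exists_word_eq t h
  exact ⟨l :: ls, by simp, hls⟩

lemma TopTransitive.exists_loop_mem (h : TopTransitive M) {c : ℕ} (hc : c ≠ b) :
    ∃ l : Loop M b, c ∈ l.1 := by
  obtain ⟨N, y, hy, hy0, hyN⟩ := h b c
  obtain ⟨N', y', hy', hy0', hyN'⟩ := h c b
  have hN : 0 < N := Nat.pos_of_ne_zero (by rintro rfl; exact hc (hyN.symm.trans hy0))
  have hN' : 0 < N' := Nat.pos_of_ne_zero (by rintro rfl; exact hc (hy0'.symm.trans hyN'))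
  have hch : (pre y N ++ [c]).IsChain M := by
    rw [← hyN, ← pre_succ_eq_append]; exact isChain_pre hy _
  obtain ⟨ls, -, hls⟩ := exists_word_eq_of_getD (M := M) (b := b) (W := pre y N ++ pre y' N')
    (List.ne_nil_of_length_pos (by simp; omega))
    (by rw [List.getD_append _ _ _ _ (by simpa using hN), pre_getD hN, hy0])
    (by rw [← hyN']; exact isChain_append_pre hy' (by rwa [hy0']) N')
  have hmem : c ∈ word ls := by
    rw [hls]; exact List.mem_append_right _ (mem_pre.2 ⟨0, hN', hy0'⟩)
  obtain ⟨l, -, hl⟩ := mem_word hc hmem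
  exact ⟨l, hl⟩

lemma TopTransitive.exists_loop_ne (h : TopTransitive M) (b : ℕ) :
    ∃ p q : Loop M b, p ≠ q := by
  obtain ⟨p, -⟩ := h.exists_loop_mem (b := b) (c := b + 1) (by omega)
  obtain ⟨c, hc⟩ := Infinite.exists_notMem_finset (b :: p.1).toFinset
  simp only [List.toFinset_cons, Finset.mem_insert, List.mem_toFinset, not_or] at hc
  obtain ⟨q, hq⟩ := h.exists_loop_mem (b := b) hc.1
  exact ⟨p, q, by rintro rfl; exact hc.2 hq⟩

lemma mass_nil_ne_top (hF : FProperty M) {t : ℝ} (h : RateLT (Zn M φ b) t) :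
    mass φ t ([] : List (Loop M b)) ≠ ∞ := by
  obtain ⟨ρ, hρ, K, hK⟩ := h.exists_forall_le fun n hn =>
    tsum_ofReal_ne_top_of_finite (hF b n hn) fun x => Real.exp (birkhoff φ n x)
  let F : (Σ n : ℕ, PerSet M b (n + 1)) → ℝ≥0∞ := fun p =>
    ENNReal.ofReal (Real.exp (birkhoff φ (p.1 + 1) p.2.1 - t * (p.1 + 1 : ℕ)))
  have hF1 : ∑' p, F p ≠ ∞ := by
    have hterm : ∀ n : ℕ, ∑' x : PerSet M b (n + 1), F ⟨n, x⟩ ≤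
        ENNReal.ofReal (Real.exp (K + ρ - t)) * ENNReal.ofReal (Real.exp (ρ - t)) ^ n := by
      intro n
      calc ∑' x : PerSet M b (n + 1), F ⟨n, x⟩
          = ENNReal.ofReal (Real.exp (- t * (n + 1 : ℕ))) * Zn M φ b (n + 1) := by
            rw [Zn, ← ENNReal.tsum_mul_left]
            refine tsum_congr fun x => ?_
            rw [← ENNReal.ofReal_mul (Real.exp_pos _).le, ← Real.exp_add]
            simp only [F]
            congr 2; ring
        _ ≤ _ := mul_le_mul_right (hK (n + 1) n.succ_pos) _
        _ = _ := by
            rw [← ENNReal.ofReal_pow (Real.exp_pos _).le, ← ENNReal.ofReal_mul (Real.exp_pos _).le,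
              ← ENNReal.ofReal_mul (Real.exp_pos _).le, ← Real.exp_add, ← Real.exp_nat_mul,
              ← Real.exp_add]
            congr 2; push_cast; ring
    rw [ENNReal.tsum_sigma' ]
    refine ne_top_of_le_ne_top ?_ (ENNReal.tsum_le_tsum hterm)
    rw [ENNReal.tsum_mul_left, ENNReal.tsum_geometric]
    refine ENNReal.mul_ne_top ENNReal.ofReal_ne_top (ENNReal.inv_ne_top.2 ?_)
    rw [ne_eq, tsub_eq_zero_iff_le, not_le, ENNReal.ofReal_lt_one, Real.exp_lt_one_iff]
    linarith
  rw [mass, tsum_list]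
  refine ENNReal.add_ne_top.2 ⟨ENNReal.ofReal_ne_top, ne_top_of_le_ne_top hF1 ?_⟩
  rw [← ENNReal.tsum_prod]
  have hne : ∀ p : Loop M b × List (Loop M b), p.1 :: p.2 ≠ [] := fun p => by simp
  have hlen : ∀ p : Loop M b × List (Loop M b),
      (word (p.1 :: p.2)).length - 1 + 1 = (word (p.1 :: p.2)).length :=
    fun p => Nat.sub_add_cancel (length_word_pos (hne p))
  let j : Loop M b × List (Loop M b) → Σ n : ℕ, PerSet M b (n + 1) := fun p =>
    ⟨(word (p.1 :: p.2)).length - 1, per (word (p.1 :: p.2)), isAdmissible_per_word (hne p),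
      by rw [hlen p]; exact shiftMap_iterate_length_per _, per_word_zero (hne p)⟩
  have hj : Function.Injective j := by
    intro p p' h
    have h1 : (word (p.1 :: p.2)).length - 1 = (word (p'.1 :: p'.2)).length - 1 :=
      congrArg Sigma.fst h
    have h2 : per (word (p.1 :: p.2)) = per (word (p'.1 :: p'.2)) :=
      congrArg (fun q : Σ n : ℕ, PerSet M b (n + 1) => q.2.1) h
    have h3 := word_injective (per_injOn_length (by rw [← hlen p, ← hlen p', h1]) h2)
    exact Prod.ext (List.cons_eq_cons.1 h3).1 (List.cons_eq_cons.1 h3).2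
  refine le_trans (le_of_eq (tsum_congr fun p => ?_)) (ENNReal.tsum_comp_le_tsum_of_injective hj F)
  simp only [F, j, wt, hlen p, List.nil_append]

lemma one_add_ofReal_exp_pow (κ : ℝ) (m : ℕ) : (1 + ENNReal.ofReal (Real.exp κ)) ^ m =
    ENNReal.ofReal (Real.exp (Real.log (1 + Real.exp κ) * m)) := by
  have h : 0 < 1 + Real.exp κ := by positivity
  rw [mul_comm, Real.exp_nat_mul, Real.exp_log h, ENNReal.ofReal_pow h.le,
    ENNReal.ofReal_add one_pos.le (Real.exp_pos _).le, ENNReal.ofReal_one]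

lemma log_one_add_exp_pos (κ : ℝ) : 0 < Real.log (1 + Real.exp κ) :=
  Real.log_pos (by linarith [Real.exp_pos κ])

lemma wt_eq_wt_add (t t' : ℝ) (ls : List (Loop M b)) :
    wt φ t ls = wt φ t' ls + (t' - t) * (word ls).length := by
  rw [wt, wt]; ring

/-! ### Strong positive recurrence implies uniform contraction along periodic orbits -/

lemma per_word_singleton_mem (x : Loop M a) :
    per (word [x]) ∈ PerStarSet M a (word [x]).length := by
  refine ⟨isAdmissible_per_word (by simp), shiftMap_iterate_length_per _,
    per_word_zero (by simp), fun k hk hk' h => x.2.1 ?_⟩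
  rw [per_of_lt hk'] at h
  obtain ⟨k, rfl⟩ : ∃ i, k = i + 1 := ⟨k - 1, by omega⟩
  have hk2 : k < x.1.length := by simpa using hk'
  have h' : x.1[k] = a := by simpa [hk2] using h
  exact List.mem_of_getElem h'

lemma le_znStar (x : Loop M a) :
    ENNReal.ofReal (Real.exp (birkhoff φ (word [x]).length (per (word [x])))) ≤
      ZnStar M φ a (word [x]).length := by
  have := per_word_singleton_mem x
  generalize per (word [x]) = z at *
  generalize (word [x]).length = n at *
  exact ENNReal.le_tsum (f := fun y : PerStarSet M a n =>
    ENNReal.ofReal (Real.exp (birkhoff φ n y.1))) ⟨z, this⟩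

/-- If first returns to `a` have exponential rate below `P`, then Birkhoff sums along closed paths
at `a` are uniformly smaller than the pressure. -/
lemma exists_wt_le (htrans : TopTransitive M) (hF : FProperty M) {C : ℝ} (hC0 : 0 ≤ C)
    (hC : DistortionBound M φ C) {P : ℝ} (hP : ∀ t > P, RateLT (Zn M φ a) t)
    (hstar : RateLT (ZnStar M φ a) P) :
    ∃ ε > 0, ∃ K : ℝ, ∀ ls : List (Loop M a), wt φ P ls ≤ K - ε * (word ls).length := by
  obtain ⟨ρ, hρ, K₀, hK₀⟩ := hstar.exists_forall_le fun n hn =>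
    tsum_ofReal_ne_top_of_finite (hF.finite_perStarSet hn) fun x => Real.exp (birkhoff φ n x)
  have hletter : ∀ x : Loop M a, wt φ P [x] ≤ K₀ - (P - ρ) * (word [x]).length := by
    intro x
    have hpos := length_word_pos (List.cons_ne_nil x [])
    have h1 := (le_znStar x).trans (hK₀ _ hpos)
    rw [ENNReal.ofReal_le_ofReal_iff (Real.exp_pos _).le, Real.exp_le_exp] at h1
    rw [wt]
    linarith
  have hwords : ∀ ls : List (Loop M a),
      wt φ P ls ≤ (K₀ + 2 * C) * ls.length - (P - ρ) * (word ls).length := by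
    intro ls
    induction ls with
    | nil => simp [wt, birkhoff]
    | cons x ls ih =>
      have h1 := (abs_le.1 (wt_append hC0 hC P [x] ls)).2
      have h2 := hletter x
      have h3 : ((word (x :: ls)).length : ℝ) = (word [x]).length + (word ls).length := by
        simp only [word_cons, word_nil, List.length_append, List.append_nil]; push_cast; ring
      rw [h3]
      simp only [List.singleton_append] at h1
      push_cast [List.length_cons]
      linarith
  obtain ⟨p, q, hpq⟩ := htrans.exists_loop_ne a
  set κ := min (wt φ (P + 1) [p]) (wt φ (P + 1) [q]) - K₀ - 8 * C with hκ
  set lam := Real.log (1 + Real.exp κ) with hlam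
  have hlam0 : 0 < lam := log_one_add_exp_pos κ
  set K := max 1 (K₀ + 2 * C) with hK
  have hK1 : 1 ≤ K := le_max_left _ _
  have hε : 0 < P - ρ := by linarith
  set s := min 1 ((P - ρ) * lam / (2 * K)) with hs
  have hs0 : 0 < s := lt_min one_pos (by positivity)
  have hs1 : s ≤ 1 := min_le_left _ _
  have hsK : K * s ≤ (P - ρ) * lam / 2 := by
    have := mul_le_mul_of_nonneg_left (min_le_right 1 ((P - ρ) * lam / (2 * K)))
      (by linarith : 0 ≤ K)
    calc K * s ≤ K * ((P - ρ) * lam / (2 * K)) := this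
      _ = _ := by field_simp
  have hexch : ∀ x : Loop M a, ∃ y, y ≠ x ∧ κ ≤ wt φ (P + s) [y] - wt φ (P + s) [x] - 8 * C := by
    intro x
    have hx : wt φ (P + s) [x] ≤ K₀ := by
      rw [wt_eq_wt_add _ P]
      have h1 := hletter x
      have h2 : (0 : ℝ) ≤ (word [x]).length := Nat.cast_nonneg _
      nlinarith
    have hy : ∀ y : Loop M a, wt φ (P + 1) [y] ≤ wt φ (P + s) [y] := by
      intro y
      rw [wt_eq_wt_add (P + s) (P + 1)]
      have h2 : (0 : ℝ) ≤ (word [y]).length := Nat.cast_nonneg _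
      nlinarith
    by_cases hxp : p = x
    · refine ⟨q, fun h => hpq (hxp.trans h.symm), ?_⟩
      linarith [hy q, min_le_right (wt φ (P + 1) [p]) (wt φ (P + 1) [q])]
    · refine ⟨p, hxp, ?_⟩
      linarith [hy p, min_le_left (wt φ (P + 1) [p]) (wt φ (P + 1) [q])]
  have hG := mass_nil_ne_top (t := P + s) hF (hP _ (by linarith))
  set g := Real.log (mass φ (P + s) ([] : List (Loop M a))).toReal with hg
  have hdecay : ∀ ls : List (Loop M a), lam * ls.length + wt φ (P + s) ls ≤ g := by
    intro ls
    have h1 := pow_mul_mass_le hC0 hC hexch [] ls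
    rw [List.nil_append, one_add_ofReal_exp_pow] at h1
    have h2 : ENNReal.ofReal (Real.exp (lam * ls.length + wt φ (P + s) ls)) ≤
        mass φ (P + s) ([] : List (Loop M a)) := by
      rw [Real.exp_add, ENNReal.ofReal_mul (Real.exp_pos _).le]
      exact (mul_le_mul_right (le_mass φ _ ls) _).trans h1
    have h3 := (ENNReal.ofReal_le_iff_le_toReal hG).1 h2
    have h4 := Real.log_le_log (Real.exp_pos _) h3
    rwa [Real.log_exp] at h4
  refine ⟨(P - ρ) * lam / 2 / (lam + K), by positivity, K * g / (lam + K), fun ls => ?_⟩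
  have h1 := hdecay ls
  rw [wt_eq_wt_add _ P] at h1
  have h2 := hwords ls
  have hn : (0 : ℝ) ≤ (word ls).length := Nat.cast_nonneg _
  have hm : (0 : ℝ) ≤ ls.length := Nat.cast_nonneg _
  have h3 : wt φ P ls ≤ K * ls.length - (P - ρ) * (word ls).length := by
    have := mul_le_mul_of_nonneg_right (le_max_right 1 (K₀ + 2 * C)) hm
    linarith
  have h4 : (lam + K) * wt φ P ls ≤ K * g - (P - ρ) * lam / 2 * (word ls).length := by
    have e1 := mul_le_mul_of_nonneg_left h1 (by linarith : 0 ≤ K)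
    have e2 := mul_le_mul_of_nonneg_left h3 hlam0.le
    have e3 := mul_le_mul_of_nonneg_right hsK hn
    linarith
  have hpos : 0 < lam + K := by linarith
  have h5 : wt φ P ls ≤ (K * g - (P - ρ) * lam / 2 * (word ls).length) / (lam + K) := by
    rw [le_div_iff₀ hpos]; linarith
  calc _ ≤ _ := h5
    _ = _ := by ring

/-- A bound for Birkhoff sums along closed paths at `a` passes to all periodic points. -/
lemma birkhoff_le_of_forall_wt_le (htrans : TopTransitive M) {C : ℝ}
    (hC : DistortionBound M φ C) {t K : ℝ} (h : ∀ ls : List (Loop M a), wt φ t ls ≤ K)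
    {x : Pt} (hx : isAdmissible M x) {n : ℕ} (hn : 0 < n) (hper : shiftMap^[n] x = x) :
    birkhoff φ n x ≤ t * n := by
  obtain ⟨N, y, hy, hy0, hyN⟩ := htrans a (x 0)
  obtain ⟨N', y', hy', hy0', hyN'⟩ := htrans (x 0) a
  set K' := K + 3 * C - birkhoff φ N y - birkhoff φ N' y' + t * N + t * N' with hK'
  have key : ∀ j : ℕ, 0 < j → j * (birkhoff φ n x - t * n) ≤ K' := by
    intro j hj
    have hjn : 0 < j * n := Nat.mul_pos hj hn
    have hxj : x (j * n) = x 0 := by simpa using apply_add_mul_of_iterate_eq hper 0 j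
    set W := pre y N ++ pre x (j * n) ++ pre y' N' with hW
    have hWlen : W.length = N + j * n + N' := by simp [hW, add_assoc]
    have hW1 : ∀ i < N, W.getD i 0 = y i := by
      intro i hi
      rw [hW, List.append_assoc, List.getD_append _ _ _ _ (by simpa using hi), pre_getD hi]
    have hW2 : ∀ i < j * n, W.getD (N + i) 0 = x i := by
      intro i hi
      rw [hW, List.append_assoc, List.getD_append_right _ _ _ _ (by simp),
        List.getD_append _ _ _ _ (by simpa using hi)]
      simp only [length_pre, Nat.add_sub_cancel_left]
      exact pre_getD hi
    have hW3 : ∀ i < N', W.getD (N + j * n + i) 0 = y' i := by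
      intro i hi
      rw [hW, List.getD_append_right _ _ _ _ (by simp)]
      simp only [List.length_append, length_pre, Nat.add_sub_cancel_left]
      exact pre_getD hi
    have hW0 : W.getD 0 0 = a := by
      rcases Nat.eq_zero_or_pos N with h0 | h0
      · have := hW2 0 hjn
        rw [h0] at this
        rw [this, ← hyN, h0, hy0]
      · rw [hW1 0 h0, hy0]
    have hchain : (W ++ [a]).IsChain M := by
      rw [← hyN', hW]
      refine isChain_append_pre hy' ?_ N'
      rw [hy0', ← hxj]
      refine isChain_append_pre hx ?_ _
      rw [← hyN, ← pre_succ_eq_append]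
      exact isChain_pre hy _
    obtain ⟨ls, hls, hword⟩ := exists_word_eq_of_getD (M := M) (b := a)
      (List.ne_nil_of_length_pos (by omega)) hW0 hchain
    set z := per W with hz
    have hzadm : isAdmissible M z := by rw [hz, ← hword]; exact isAdmissible_per_word hls
    have hzlen : z (N + j * n + N') = a := by
      have := congrFun (shiftMap_iterate_length_per W) 0
      rw [shiftMap_iterate, zero_add, hWlen] at this
      rw [hz, this, per_of_lt (by omega), hW0]
    have hz3 : ∀ i ≤ N', z (N + j * n + i) = y' i := by
      intro i hi
      rcases hi.lt_or_eq with hi | rfl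
      · rw [hz, per_of_lt (by omega), hW3 i hi]
      · rw [hzlen, hyN']
    have hz2 : ∀ i ≤ j * n, z (N + i) = x i := by
      intro i hi
      rcases hi.lt_or_eq with hi | rfl
      · rw [hz, per_of_lt (by omega), hW2 i hi]
      · rw [hxj, ← hy0']; exact hz3 0 (by omega)
    have hz1 : ∀ i ≤ N, z i = y i := by
      intro i hi
      rcases hi.lt_or_eq with hi | rfl
      · rw [hz, per_of_lt (by omega), hW1 i hi]
      · rw [hyN]; exact hz2 0 (by omega)
    have d1 := (abs_le.1 (hC N z y hzadm hy hz1)).1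
    have d2 := (abs_le.1 (hC (j * n) _ x (hzadm.shift N) hx fun i hi => by
      rw [shiftMap_iterate, add_comm]; exact hz2 i hi)).1
    have d3 := (abs_le.1 (hC N' _ y' (hzadm.shift (N + j * n)) hy' fun i hi => by
      rw [shiftMap_iterate, add_comm]; exact hz3 i hi)).1
    have hb := h ls
    rw [wt, hword, hWlen, ← hz, birkhoff_add, birkhoff_add] at hb
    rw [birkhoff_mul_of_periodic φ hper] at d2
    push_cast at hb
    rw [hK']
    linarith
  by_contra! hlt
  obtain ⟨j, hj⟩ := exists_nat_gt (K' / (birkhoff φ n x - t * n))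
  have hpos : 0 < birkhoff φ n x - t * n := by linarith
  rw [div_lt_iff₀ hpos] at hj
  have h1 := key (j + 1) j.succ_pos
  push_cast at h1
  linarith

lemma chiPer_le_iff {t : ℝ} : chiPer M φ ≤ (t : EReal) ↔
    ∀ (x : Pt) (n : ℕ), isAdmissible M x → 0 < n → shiftMap^[n] x = x →
      birkhoff φ n x ≤ t * n := by
  rw [chiPer, iSup_le_iff]
  constructor
  · intro h x n hx hn hper
    have := h ⟨(x, n), hx, hn, hper⟩
    rwa [EReal.coe_le_coe_iff, div_le_iff₀ (by exact_mod_cast hn)] at this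
  · rintro h ⟨⟨x, n⟩, hx, hn, hper⟩
    have hn' : (0 : ℝ) < n := by exact_mod_cast hn
    rw [EReal.coe_le_coe_iff, div_le_iff₀ hn']
    exact h x n hx hn hper

lemma chiPer_lt_of_spr (htrans : TopTransitive M) (hF : FProperty M)
    (hsum : SummableVariations M φ) {P : ℝ} (hP : ∀ a, pressureAt M φ a = (P : EReal))
    (h : SPR M φ P) : chiPer M φ < (P : EReal) := by
  obtain ⟨a, ha⟩ := h
  obtain ⟨C, hC0, hC⟩ := hsum.exists_distortionBound
  obtain ⟨ε, hε, K, hK⟩ := exists_wt_le htrans hF hC0 hC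
    (fun t ht => limsup_lt_iff_rateLT.1 ((hP a).trans_lt (EReal.coe_lt_coe_iff.2 ht)))
    (limsup_lt_iff_rateLT.1 ha)
  refine lt_of_le_of_lt (b := ((P - ε : ℝ) : EReal)) (chiPer_le_iff.2 fun x n hx hn hper => ?_)
    (EReal.coe_lt_coe_iff.2 (by linarith))
  refine birkhoff_le_of_forall_wt_le (a := a) (K := K) htrans hC (fun ls => ?_) hx hn hper
  rw [wt_eq_wt_add _ P]
  linarith [hK ls]

/-! ### Uniform contraction along periodic orbits implies strong positive recurrence -/

/-- The rotation of the word `w` starting at the first occurrence of `a`. -/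
def rotateTo (a : ℕ) (w : List ℕ) : List ℕ :=
  w.dropWhile (fun c => c ≠ a) ++ w.takeWhile (fun c => c ≠ a)

lemma rotateTo_append_cons {U V : List ℕ} (hU : a ∉ U) :
    rotateTo a (U ++ a :: V) = a :: V ++ U := by
  have h : ∀ c ∈ U, decide (c ≠ a) = true := fun c hc => by
    simpa using fun h : c = a => hU (h ▸ hc)
  rw [rotateTo, List.takeWhile_append_of_pos h, List.dropWhile_append_of_pos h]
  simp

/-- A first-return orbit to `a` visiting `b` more than `r` times is encoded by a list of loops at
`b`, the first `r` of which avoid `a`. -/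
lemma exists_loops_of_mem_perStarSet (hab : b ≠ a) {n r : ℕ} {x : Pt}
    (hx : x ∈ PerStarSet M a n) (hr : r < (pre x n).count b) (t : ℝ) :
    ∃ ls : List (Loop M b), r ≤ ls.length ∧ (∀ l ∈ ls.take r, a ∉ l.1) ∧
      wt φ t ls = birkhoff φ n x - t * n ∧ rotateTo a (word ls) = pre x n := by
  obtain ⟨hadm, hper, hx0, hret⟩ := hx
  have hmem : b ∈ pre x n := List.count_pos_iff.1 (by omega)
  have hn : 0 < n := by
    obtain ⟨k, hk, -⟩ := mem_pre.1 hmem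
    omega
  obtain ⟨p, s, hps, hbp⟩ := List.eq_append_cons_of_mem hmem
  have hxn : x n = a := by
    have := congrFun hper 0
    rw [shiftMap_iterate, zero_add] at this
    rw [this, hx0]
  obtain ⟨m, rfl⟩ : ∃ m, n = m + 1 := ⟨n - 1, by omega⟩
  have hatail : a ∉ pre (shiftMap x) m := by
    rintro h
    obtain ⟨k, hk, hka⟩ := mem_pre.1 h
    exact hret (k + 1) k.succ_pos (by omega) hka
  obtain ⟨p', rfl⟩ : ∃ p', p = a :: p' := by
    rw [pre_succ_eq_cons, hx0] at hps
    cases p with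
    | nil => exact absurd (List.cons_eq_cons.1 hps).1.symm hab
    | cons c p' => exact ⟨p', by rw [(List.cons_eq_cons.1 hps).1]⟩
  have htail : pre (shiftMap x) m = p' ++ b :: s := by
    rw [pre_succ_eq_cons, hx0] at hps
    exact (List.cons_eq_cons.1 hps).2
  have haU : a ∉ b :: s := fun h => hatail (by rw [htail]; exact List.mem_append_right _ h)
  have hchain : (pre x (m + 1) ++ [a]).IsChain M := by
    rw [← hxn, ← pre_succ_eq_append]; exact isChain_pre hadm _
  have hchain1 : (a :: p' ++ b :: (s ++ [a])).IsChain M := by rw [hps] at hchain; simpa using hchain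
  obtain ⟨hc1, hc2⟩ := List.isChain_split.1 hchain1
  have hclosed : (b :: (s ++ a :: p') ++ [b]).IsChain M := by
    have : (b :: s ++ a :: (p' ++ [b])).IsChain M :=
      List.isChain_split.2 ⟨by simpa using hc2, by simpa using hc1⟩
    simpa using this
  obtain ⟨l₀, ls₀, hword⟩ := exists_word_eq _ hclosed
  have hword' : word (l₀ :: ls₀) = (b :: s) ++ a :: p' := by rw [hword]; simp
  have hne : l₀ :: ls₀ ≠ [] := List.cons_ne_nil _ _
  generalize l₀ :: ls₀ = ls at hword' hne
  have hcount : ls.length = (pre x (m + 1)).count b := by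
    rw [← count_word, hword', hps, List.count_append, List.count_append, add_comm]
  refine ⟨ls, by omega, ?_, ?_, ?_⟩
  · obtain ⟨ls₁, l, rfl⟩ : ∃ ls₁ l, ls = ls₁ ++ [l] :=
      ⟨ls.dropLast, ls.getLast hne, (List.dropLast_append_getLast hne).symm⟩
    have ha₁ : a ∉ word ls₁ := by
      have h : word ls₁ ++ b :: l.1 = (b :: s) ++ a :: p' := by rw [← hword']; simp
      rcases List.append_eq_append_iff.1 h with ⟨as, h1, -⟩ | ⟨bs, -, h2⟩
      · exact fun h => haU (by rw [h1]; exact List.mem_append_left _ h)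
      · exact absurd (by rw [h2]; simp) hbp
    intro l' hl' hal'
    rw [List.length_append, List.length_singleton] at hcount
    rw [List.take_append_of_le_length (by omega)] at hl'
    exact ha₁ (mem_word_of_mem (List.mem_of_mem_take hl') hal')
  · have hlen : (word ls).length = m + 1 := by
      have := congrArg List.length hps
      rw [length_pre] at this
      rw [hword', this]; simp only [List.length_append]; omega
    have hpt : per (word ls) = shiftMap^[(a :: p').length] x := by
      rw [hword', ← shiftMap_iterate_per_append, ← hps, per_pre hn hper]
    rw [wt, hlen, hpt, birkhoff_iterate_of_periodic φ hper]
  · rw [hword', rotateTo_append_cons haU, hps]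

/-- The part of `ZnStar` carried by orbits visiting `b` more than `r` times. -/
noncomputable def visitSum (M : ℕ → ℕ → Prop) (φ : Pt → ℝ) (a b n r : ℕ) : ℝ≥0∞ :=
  ∑' x : PerStarSet M a n,
    if r < (pre x.1 n).count b then ENNReal.ofReal (Real.exp (birkhoff φ n x.1)) else 0

lemma visitSum_le_massOn (hab : b ≠ a) (n r : ℕ) (t : ℝ) :
    visitSum M φ a b n r ≤ ENNReal.ofReal (Real.exp (t * n)) *
      massOn φ t {l : Loop M b | a ∉ l.1} r [] := by
  classical
  let X := {x : Pt | x ∈ PerStarSet M a n ∧ r < (pre x n).count b}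
  have h : ∀ x : X, ∃ ls : List (Loop M b), r ≤ ls.length ∧ (∀ l ∈ ls.take r, a ∉ l.1) ∧
      wt φ t ls = birkhoff φ n x - t * n ∧ rotateTo a (word ls) = pre x n :=
    fun x => exists_loops_of_mem_perStarSet hab x.2.1 x.2.2 t
  choose j hj1 hj2 hj3 hj4 using h
  have hj : Function.Injective j := by
    intro x y hxy
    have h1 : pre x.1 n = pre y.1 n := by rw [← hj4 x, ← hj4 y, hxy]
    have hn : 0 < n := by
      have := x.2.2
      by_contra h0
      obtain rfl : n = 0 := by omega
      simp [pre] at this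
    refine Subtype.ext ?_
    rw [← per_pre hn x.2.1.2.1, ← per_pre hn y.2.1.2.1, h1]
  have hsum : visitSum M φ a b n r =
      ∑' x : X, ENNReal.ofReal (Real.exp (birkhoff φ n x.1)) := by
    rw [visitSum, tsum_subtype (PerStarSet M a n) (fun x => if r < (pre x n).count b then
      ENNReal.ofReal (Real.exp (birkhoff φ n x)) else 0),
      tsum_subtype X fun x => ENNReal.ofReal (Real.exp (birkhoff φ n x))]
    refine tsum_congr fun x => ?_
    simp only [Set.indicator_apply, X, Set.mem_ofPred_eq]
    split_ifs <;> simp_all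
  rw [hsum, massOn, ← ENNReal.tsum_mul_left]
  refine le_trans (le_of_eq (tsum_congr fun x => ?_))
    (ENNReal.tsum_comp_le_tsum_of_injective hj _)
  rw [if_pos ⟨hj1 x, hj2 x⟩, List.nil_append, hj3, ← ENNReal.ofReal_mul (Real.exp_pos _).le,
    ← Real.exp_add]
  congr 2; ring

/-- Orbits returning to `a` that visit `b` with positive frequency have growth rate below `P`. -/
lemma rateLT_visitSum (htrans : TopTransitive M) (hF : FProperty M) {C : ℝ} (hC0 : 0 ≤ C)
    (hC : DistortionBound M φ C) {P : ℝ} (hP : ∀ t > P, RateLT (Zn M φ b) t) (hab : b ≠ a)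
    {κ : ℝ} (hκ : 0 < κ) : RateLT (fun n => visitSum M φ a b n ⌊κ * n⌋₊) P := by
  obtain ⟨u, hu⟩ := htrans.exists_loop_mem hab.symm
  set k := wt φ (P + 1) [u] - 6 * C with hk
  set lam := Real.log (1 + Real.exp k) with hlam
  have hlam0 : 0 < lam := log_one_add_exp_pos k
  set s := min 1 (κ * lam / 2) with hs
  have hs0 : 0 < s := lt_min one_pos (by positivity)
  have hs1 : s ≤ 1 := min_le_left _ _
  have hs2 : s ≤ κ * lam / 2 := min_le_right _ _
  have hG := mass_nil_ne_top (t := P + s) hF (hP _ (by linarith))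
  have hku : k ≤ wt φ (P + s) [u] - 6 * C := by
    rw [wt_eq_wt_add (P + s) (P + 1)]
    have h2 : (0 : ℝ) ≤ (word [u]).length := Nat.cast_nonneg _
    nlinarith
  have hdecay := fun r => pow_mul_massOn_le hC0 hC (S := {l : Loop M b | a ∉ l.1})
    (by simpa using hu) hku r []
  set G := mass φ (P + s) ([] : List (Loop M b))
  have hGle : G ≤ ENNReal.ofReal (Real.exp (Real.log G.toReal)) := by
    rw [← ENNReal.ofReal_toReal hG, ENNReal.toReal_ofReal ENNReal.toReal_nonneg]
    exact ENNReal.ofReal_le_ofReal (Real.le_exp_log _)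
  refine RateLT.of_le_exp (K := lam + Real.log G.toReal) (ρ := P - κ * lam / 2)
    (by nlinarith) (Eventually.of_forall fun n => ?_)
  set r := ⌊κ * n⌋₊ with hr
  have hrn : κ * n ≤ r + 1 := (Nat.lt_floor_add_one _).le
  have h1 : massOn φ (P + s) {l : Loop M b | a ∉ l.1} r [] ≤
      ENNReal.ofReal (Real.exp (-(lam * r) + Real.log G.toReal)) := by
    have h2 := (hdecay r).trans hGle
    rw [one_add_ofReal_exp_pow] at h2
    calc _ = ENNReal.ofReal (Real.exp (-(lam * r))) * (ENNReal.ofReal (Real.exp (lam * r)) *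
          massOn φ (P + s) {l : Loop M b | a ∉ l.1} r []) := by
          rw [← mul_assoc, ← ENNReal.ofReal_mul (Real.exp_pos _).le, ← Real.exp_add]
          simp
      _ ≤ _ := mul_le_mul_right h2 _
      _ = _ := by rw [← ENNReal.ofReal_mul (Real.exp_pos _).le, ← Real.exp_add]
  refine (visitSum_le_massOn hab n r (P + s)).trans ((mul_le_mul_right h1 _).trans ?_)
  rw [← ENNReal.ofReal_mul (Real.exp_pos _).le, ← Real.exp_add]
  refine ENNReal.ofReal_le_ofReal (Real.exp_le_exp.2 ?_)
  have hn : (0 : ℝ) ≤ n := n.cast_nonneg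
  nlinarith [mul_le_mul_of_nonneg_right hs2 hn, mul_le_mul_of_nonneg_left hrn hlam0.le]

/-- The part of `ZnStar` carried by orbits spending a small proportion of time in `{0, …, q}`. -/
noncomputable def rareSum (M : ℕ → ℕ → Prop) (φ : Pt → ℝ) (a n M' q : ℕ) : ℝ≥0∞ :=
  ∑' x : {x : Pt | x ∈ PerStarSet M a n ∧ inBSet M n M' q x},
    ENNReal.ofReal (Real.exp (birkhoff φ n x.1))

lemma rareSum_le {t : ℝ} (hχ : chiPer M φ ≤ (t : EReal)) {n : ℕ} (hn : 0 < n) (M' q : ℕ) :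
    rareSum M φ a n M' q ≤ ENNReal.ofReal (Real.exp (t * n)) * zCount M n M' q := by
  rw [rareSum, zCount, ← ENNReal.tsum_mul_left]
  let j : {x : Pt | x ∈ PerStarSet M a n ∧ inBSet M n M' q x} → {w : Fin (n + 1) → ℕ //
      (∃ x : Pt, isAdmissible M x ∧ ∀ i : Fin (n + 1), x (i : ℕ) = w i) ∧
      w 0 ≤ q ∧ w (Fin.last n) ≤ q ∧
      (((Finset.univ.filter (fun i : Fin (n + 1) => w i ≤ q)).card : ℝ) ≤
        (n + 1 : ℝ) / (M' : ℝ))} := fun x =>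
    ⟨fun i => x.1 i, ⟨x.1, x.2.1.1, fun _ => rfl⟩, by simpa using x.2.2.2.1,
      by simpa using x.2.2.2.2.1, by
        convert x.2.2.2.2.2 using 2
        simp only [Finset.card_filter, Finset.sum_range]⟩
  have hj : Function.Injective j := by
    intro x y h
    have h1 : ∀ i < n, x.1 i = y.1 i := fun i hi =>
      congrFun (congrArg Subtype.val h) ⟨i, by omega⟩
    refine Subtype.ext ?_
    rw [← per_pre hn x.2.1.2.1, ← per_pre hn y.2.1.2.1]
    congr 1
    exact List.map_congr_left fun i hi => h1 i (List.mem_range.1 hi)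
  refine le_trans (ENNReal.tsum_le_tsum fun x => ?_)
    (ENNReal.tsum_comp_le_tsum_of_injective hj _)
  rw [mul_one]
  exact ENNReal.ofReal_le_ofReal (Real.exp_le_exp.2
    (chiPer_le_iff.1 hχ x.1 n x.2.1.1 hn x.2.1.2.1))

lemma count_pre (x : Pt) (n b : ℕ) :
    (pre x n).count b = ((Finset.range n).filter (fun k => x k = b)).card := by
  induction n with
  | zero => simp [pre]
  | succ n ih =>
    rw [pre_succ_eq_append, List.count_append, ih, Finset.range_add_one, Finset.filter_insert]
    split_ifs with h <;> simp [h]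

/-- A first-return orbit that does not rarely visit `{0, …, q}` visits one symbol often. -/
lemma exists_count_gt {q M' n : ℕ} (hM' : 0 < M') (haq : a ≤ q) (hn : 4 * M' ≤ n) {x : Pt}
    (hx : x ∈ PerStarSet M a n) (hB : ¬ inBSet M n M' q x) :
    ∃ b ∈ (Finset.range (q + 1)).erase a,
      ⌊(1 / (2 * M' * (q + 1)) : ℝ) * n⌋₊ < (pre x n).count b := by
  obtain ⟨hadm, hper, hx0, hret⟩ := hx
  have hxn : x n = a := by
    have := congrFun hper 0
    rw [shiftMap_iterate, zero_add] at this
    rw [this, hx0]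
  by_contra! hcon
  refine hB ⟨hadm, by omega, by omega, ?_⟩
  set R := ⌊(1 / (2 * M' * (q + 1)) : ℝ) * n⌋₊ with hR
  have hsub : (Finset.range (n + 1)).filter (fun k => x k ≤ q) ⊆
      {0, n} ∪ ((Finset.range (q + 1)).erase a).biUnion
        fun b => (Finset.range n).filter (fun k => x k = b) := by
    intro k hk
    simp only [Finset.mem_filter, Finset.mem_range] at hk
    simp only [Finset.mem_union, Finset.mem_insert, Finset.mem_singleton, Finset.mem_biUnion,
      Finset.mem_erase, Finset.mem_range, Finset.mem_filter]
    by_cases h0 : k = 0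
    · exact Or.inl (Or.inl h0)
    by_cases hkn : k = n
    · exact Or.inl (Or.inr hkn)
    · exact Or.inr ⟨x k, ⟨hret k (by omega) (by omega), by omega⟩, by omega, rfl⟩
  have hcard : ((Finset.range (n + 1)).filter (fun k => x k ≤ q)).card ≤ 2 + (q + 1) * R := by
    refine (Finset.card_le_card hsub).trans ((Finset.card_union_le _ _).trans ?_)
    refine add_le_add Finset.card_le_two ?_
    refine (Finset.card_biUnion_le_card_mul _ _ R fun b hb => ?_).trans ?_
    · rw [← count_pre]; exact hcon b hb
    · refine Nat.mul_le_mul_right _ ((Finset.card_erase_le).trans ?_)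
      simp
  have hM0 : (0 : ℝ) < M' := by exact_mod_cast hM'
  have hRle : (R : ℝ) ≤ (1 / (2 * M' * (q + 1)) : ℝ) * n := Nat.floor_le (by positivity)
  have hcard' : (((Finset.range (n + 1)).filter (fun k => x k ≤ q)).card : ℝ) ≤
      2 + (q + 1) * R := by exact_mod_cast hcard
  have hn' : (4 * M' : ℝ) ≤ n := by exact_mod_cast hn
  have hq : (0 : ℝ) < q + 1 := by positivity
  have h1 : ((q : ℝ) + 1) * R ≤ n / (2 * M') := by
    calc ((q : ℝ) + 1) * R ≤ (q + 1) * ((1 / (2 * M' * (q + 1)) : ℝ) * n) := by gcongr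
      _ = _ := by field_simp
  have h2 : (2 : ℝ) ≤ n / (2 * M') := by rw [le_div_iff₀ (by positivity)]; linarith
  calc _ ≤ _ := hcard'
    _ ≤ (n : ℝ) / (2 * M') + n / (2 * M') := by linarith
    _ = n / M' := by field_simp; ring
    _ ≤ _ := by gcongr; linarith

lemma znStar_le {q M' n : ℕ} (hM' : 0 < M') (haq : a ≤ q) (hn : 4 * M' ≤ n) :
    ZnStar M φ a n ≤ rareSum M φ a n M' q + ∑ b ∈ (Finset.range (q + 1)).erase a,
      visitSum M φ a b n ⌊(1 / (2 * M' * (q + 1)) : ℝ) * n⌋₊ := by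
  classical
  have hrare : rareSum M φ a n M' q = ∑' x : PerStarSet M a n,
      if inBSet M n M' q x then ENNReal.ofReal (Real.exp (birkhoff φ n x.1)) else 0 := by
    rw [rareSum, tsum_subtype (PerStarSet M a n) (fun x => if inBSet M n M' q x then
      ENNReal.ofReal (Real.exp (birkhoff φ n x)) else 0), tsum_subtype
      {x : Pt | x ∈ PerStarSet M a n ∧ inBSet M n M' q x}
      fun x => ENNReal.ofReal (Real.exp (birkhoff φ n x))]
    refine tsum_congr fun x => ?_
    simp only [Set.indicator_apply, Set.mem_ofPred_eq]
    split_ifs <;> simp_all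
  simp only [visitSum]
  rw [hrare, ← Summable.tsum_finsetSum (fun _ _ => ENNReal.summable), ← ENNReal.tsum_add]
  refine ENNReal.tsum_le_tsum fun x => ?_
  by_cases hB : inBSet M n M' q x
  · rw [if_pos hB]; exact le_self_add
  · obtain ⟨b, hb, hcount⟩ := exists_count_gt hM' haq hn x.2 hB
    refine le_trans ?_ le_add_self
    refine le_trans ?_ (Finset.single_le_sum (fun _ _ => zero_le) hb)
    rw [if_pos hcount]

lemma spr_of_chiPer_lt (htrans : TopTransitive M) (hF : FProperty M)
    (hsum : SummableVariations M φ) {P : ℝ} (hP : ∀ a, pressureAt M φ a = (P : EReal))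
    (hinf : hInfty M = 0) (h : chiPer M φ < (P : EReal)) : SPR M φ P := by
  obtain ⟨C, hC0, hC⟩ := hsum.exists_distortionBound
  obtain ⟨t, hχ, ht⟩ := EReal.lt_iff_exists_real_btwn.1 h
  have ht := EReal.coe_lt_coe_iff.1 ht
  set δ := (P - t) / 2 with hδ
  have hδ0 : 0 < δ := by linarith
  have hinf' : hInfty M < (δ : EReal) := by rw [hinf]; exact_mod_cast hδ0
  obtain ⟨q, hq⟩ := (frequently_lt_of_liminf_lt (by isBoundedDefault) hinf').exists
  obtain ⟨M', hM'lt, hM'⟩ := ((frequently_lt_of_liminf_lt (by isBoundedDefault) hq).and_eventually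
    (eventually_gt_atTop 0)).exists
  obtain ⟨ρ, hρ, hz⟩ := limsup_lt_iff_rateLT.1 hM'lt
  have hrare : RateLT (fun n => rareSum M φ 0 n M' q) P := by
    refine ⟨t + ρ, by linarith, ?_⟩
    filter_upwards [hz, eventually_gt_atTop 0] with n hzn hn
    refine (rareSum_le hχ.le hn M' q).trans ((mul_le_mul_right hzn _).trans (le_of_eq ?_))
    rw [← ENNReal.ofReal_mul (Real.exp_pos _).le, ← Real.exp_add, add_mul]
  have hM0 : (0 : ℝ) < M' := by exact_mod_cast hM'
  have hvisit : RateLT (fun n => ∑ b ∈ (Finset.range (q + 1)).erase 0,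
      visitSum M φ 0 b n ⌊(1 / (2 * M' * (q + 1)) : ℝ) * n⌋₊) P :=
    RateLT.sum _ fun b hb => rateLT_visitSum htrans hF hC0 hC
      (fun t ht => limsup_lt_iff_rateLT.1 ((hP b).trans_lt (EReal.coe_lt_coe_iff.2 ht)))
      (Finset.ne_of_mem_erase hb) (by positivity)
  refine ⟨0, limsup_lt_iff_rateLT.2 ((hrare.add hvisit).mono ?_)⟩
  filter_upwards [eventually_ge_atTop (4 * M')] with n hn
  exact znStar_le hM' (Nat.zero_le q) hn

end CMS

/-- Theorem `thm:UCS-SPR`.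
For a topologically transitive countable Markov shift with the F-property, a
potential `φ` with summable variations, finite Gurevich pressure `P = P(φ)` and
entropy at infinity `h_∞ = 0`, condition (UCS), i.e. `χ_per(φ) < P(φ)`, holds
if and only if `φ` is strongly positive recurrent. -/
theorem UCS_iff_SPR
    (M : ℕ → ℕ → Prop) (φ : Pt → ℝ)
    (htrans : TopTransitive M) (hF : FProperty M)
    (hsum : SummableVariations M φ)
    (P : ℝ) (hP : ∀ a : ℕ, pressureAt M φ a = (P : EReal))
    (hinf : hInfty M = (0 : EReal)) :
    chiPer M φ < (P : EReal) ↔ SPR M φ P :=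
  ⟨CMS.spr_of_chiPer_lt htrans hF hsum hP hinf, CMS.chiPer_lt_of_spr htrans hF hsum hP⟩
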